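/- arXiv:2105.12379 — 2 statements merged into one kernel-verified Lean document; each statement's English description precedes it below -/
import Mathlib

section
/- Conditional stability of the semi-implicit scheme without solid correction (Algorithm 2) with first-order extrapolation: Suppose (uᵐ)_{m≥0} ⊆ F, (ḋᵐ)_{m≥0} ⊆ W_h and d⁰ ∈ W_h are given, set dᵐ = dᵐ⁻¹ + τḋᵐ for m ≥ 1, and suppose the nonnegative reals (δ_m)_{m≥1} are such that for every m ≥ 1 the tested scheme equation ρ_f⟨uᵐ − uᵐ⁻¹, uᵐ⟩_F + δ_m + ρ_s ε⟨ḋᵐ − ḋᵐ⁻¹, ḋᵐ⟩_S + a(dᵐ⁻¹, dᵐ − dᵐ⁻¹) = 0 holds (the elastic force is evaluated at the extrapolation d^{m⋆} = dᵐ⁻¹). Assume the CFL-type condition: there exists α > 0 such that τ‖w‖_s² ≤ α‖w‖_S² for all w ∈ W_h (in the thesis this follows from τ β_s C_I²/h_s² ≤ α via the inverse inequality on a quasi-uniform solid mesh) and τα < ρ_s ε. Then for every n ≥ 1: Eⁿ + Σ_{m=1}^{n} δ_m + τ² Σ_{m=1}^{n} [(ρ_f/2)‖∂_τ uᵐ‖_F²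 + (ρ_s ε/2)‖∂_τ ḋᵐ‖_S²] ≤ exp(nτα/(ρ_s ε − τα)) · E⁰, where Eᵐ = (ρ_f/2)‖uᵐ‖_F² + (ρ_s ε/2)‖ḋᵐ‖_S² + (1/2)‖dᵐ‖_s². -/
open RealInnerProductSpace

/-- Implicit discrete Grönwall inequality: if each step amplifies the energy `E` by at most
`t / c * E (k + 1)` while dissipating `D (k + 1)`, then energy plus accumulated dissipation
grows at most exponentially. -/
theorem discrete_gronwall_with_dissipation {E D : ℕ → ℝ} {t c : ℝ} (ht : 0 ≤ t) (htc : t < c)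
    (hE : ∀ k, 0 ≤ E k) (hD : ∀ k, 0 ≤ D (k + 1))
    (hstep : ∀ k, c * (E (k + 1) + D (k + 1)) ≤ c * E k + t * E (k + 1)) (n : ℕ) :
    E n + ∑ m ∈ Finset.Icc 1 n, D m ≤ Real.exp (n * (t / (c - t))) * E 0 := by
  have hct : 0 < c - t := sub_pos.2 htc
  induction n with
  | zero => simp
  | succ n ih =>
    rw [Finset.sum_Icc_succ_top (by omega)]
    have hsum : 0 ≤ ∑ m ∈ Finset.Icc 1 n, D m :=
      Finset.sum_nonneg fun m hm => by
        obtain ⟨k, rfl⟩ := Nat.exists_eq_add_of_le' (Finset.mem_Icc.1 hm).1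
        exact hD k
    set s := ∑ m ∈ Finset.Icc 1 n, D m
    have hfactor : E (n + 1) + (s + D (n + 1)) ≤ (t / (c - t) + 1) * (E n + s) := by
      have h : t / (c - t) + 1 = c / (c - t) := by
        field_simp
        ring
      rw [h, div_mul_eq_mul_div, le_div_iff₀ hct]
      nlinarith [hstep n, mul_nonneg ht hsum, mul_nonneg ht (hD n)]
    calc E (n + 1) + (s + D (n + 1))
        ≤ (t / (c - t) + 1) * (E n + s) := hfactor
      _ ≤ Real.exp (t / (c - t)) * (E n + s) :=
          mul_le_mul_of_nonneg_right (Real.add_one_le_exp _) (add_nonneg (hE n) hsum)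
      _ ≤ Real.exp (t / (c - t)) * (Real.exp (n * (t / (c - t))) * E 0) :=
          mul_le_mul_of_nonneg_left ih (Real.exp_pos _).le
      _ = Real.exp ((n + 1 : ℕ) * (t / (c - t))) * E 0 := by
          rw [← mul_assoc, ← Real.exp_add]
          push_cast
          ring_nf

theorem real_inner_sub_self_left_eq {V : Type*} [NormedAddCommGroup V] [InnerProductSpace ℝ V]
    (x y : V) : ⟪x - y, x⟫ = (‖x‖ ^ 2 - ‖y‖ ^ 2 + ‖x - y‖ ^ 2) / 2 := by
  rw [norm_sub_sq_real, inner_sub_left, real_inner_self_eq_norm_sq, real_inner_comm]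
  ring

theorem sq_mul_norm_one_div_smul_sq {V : Type*} [NormedAddCommGroup V] [NormedSpace ℝ V]
    {r : ℝ} (hr : r ≠ 0) (x : V) : r ^ 2 * ‖(1 / r) • x‖ ^ 2 = ‖x‖ ^ 2 := by
  rw [norm_smul, mul_pow, Real.norm_eq_abs, sq_abs]
  field_simp

/-- Conditional stability of the semi-implicit scheme without solid correction
(Algorithm 2) with first-order extrapolation `d^{m⋆} = dᵐ⁻¹`. -/
theorem algorithm2_conditional_stability_first_order
    {F S : Type*}
    [NormedAddCommGroup F] [InnerProductSpace ℝ F] [CompleteSpace F]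
    [NormedAddCommGroup S] [InnerProductSpace ℝ S] [CompleteSpace S]
    (Wh : Submodule ℝ S) [FiniteDimensional ℝ Wh]
    (a : S → S → ℝ)
    (hsymm : ∀ u ∈ Wh, ∀ v ∈ Wh, a u v = a v u)
    (hadd : ∀ u ∈ Wh, ∀ v ∈ Wh, ∀ w ∈ Wh, a (u + v) w = a u w + a v w)
    (hsmul : ∀ (c : ℝ), ∀ u ∈ Wh, ∀ w ∈ Wh, a (c • u) w = c * a u w)
    (hpos : ∀ w ∈ Wh, w ≠ 0 → 0 < a w w)
    (ρf ρs ε τ : ℝ) (hρf : 0 < ρf) (hρs : 0 < ρs) (hε : 0 < ε) (hτ : 0 < τ)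
    (u : ℕ → F) (d ddot : ℕ → S) (δ : ℕ → ℝ)
    (hddot_mem : ∀ m, ddot m ∈ Wh) (hd0_mem : d 0 ∈ Wh)
    (hδ : ∀ m, 1 ≤ m → 0 ≤ δ m)
    (hd : ∀ m, 1 ≤ m → d m = d (m - 1) + τ • ddot m)
    (hscheme : ∀ m, 1 ≤ m →
      ρf * ⟪u m - u (m - 1), u m⟫ + δ m
        + ρs * ε * ⟪ddot m - ddot (m - 1), ddot m⟫
        + a (d (m - 1)) (d m - d (m - 1)) = 0)
    (α : ℝ) (hα : 0 < α)
    (hCFL : ∀ w ∈ Wh, τ * a w w ≤ α * ‖w‖ ^ 2)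
    (hτα : τ * α < ρs * ε) :
    ∀ n, 1 ≤ n →
      (ρf / 2 * ‖u n‖ ^ 2 + ρs * ε / 2 * ‖ddot n‖ ^ 2 + 1 / 2 * a (d n) (d n))
        + (∑ m ∈ Finset.Icc 1 n, δ m)
        + τ ^ 2 * ∑ m ∈ Finset.Icc 1 n,
            (ρf / 2 * ‖(1 / τ) • (u m - u (m - 1))‖ ^ 2
              + ρs * ε / 2 * ‖(1 / τ) • (ddot m - ddot (m - 1))‖ ^ 2)
      ≤ Real.exp ((n : ℝ) * τ * α / (ρs * ε - τ * α)) *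
          (ρf / 2 * ‖u 0‖ ^ 2 + ρs * ε / 2 * ‖ddot 0‖ ^ 2 + 1 / 2 * a (d 0) (d 0)) := by
  have ha_nonneg : ∀ w ∈ Wh, 0 ≤ a w w := fun w hw => by
    rcases eq_or_ne w 0 with rfl | h
    · have h0 := hsmul 0 0 hw 0 hw
      rw [zero_smul, zero_mul] at h0
      exact h0.ge
    · exact (hpos w hw h).le
  have hd_mem : ∀ m, d m ∈ Wh := fun m => by
    induction m with
    | zero => exact hd0_mem
    | succ k ih =>
      rw [hd (k + 1) k.succ_pos]
      exact Wh.add_mem ih (Wh.smul_mem _ (hddot_mem _))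
  have hpolar : ∀ x ∈ Wh, ∀ v ∈ Wh, a x v = (a (x + v) (x + v) - a x x - a v v) / 2 :=
    fun x hx v hv => by
      have hxv := Wh.add_mem hx hv
      rw [hadd x hx v hv _ hxv, hsymm x hx _ hxv, hsymm v hv _ hxv, hadd x hx v hv _ hx,
        hadd x hx v hv _ hv, hsymm v hv x hx]
      ring
  have hquad : ∀ w ∈ Wh, a (τ • w) (τ • w) = τ ^ 2 * a w w := fun w hw => by
    have hτw := Wh.smul_mem τ hw
    rw [hsmul τ w hw _ hτw, hsymm w hw _ hτw, hsmul τ w hw w hw]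
    ring
  have hρ : 0 < ρs * ε := mul_pos hρs hε
  intro n _
  have key := discrete_gronwall_with_dissipation
    (E := fun m => ρf / 2 * ‖u m‖ ^ 2 + ρs * ε / 2 * ‖ddot m‖ ^ 2 + 1 / 2 * a (d m) (d m))
    (D := fun m => δ m + τ ^ 2 * (ρf / 2 * ‖(1 / τ) • (u m - u (m - 1))‖ ^ 2
      + ρs * ε / 2 * ‖(1 / τ) • (ddot m - ddot (m - 1))‖ ^ 2))
    (t := τ * α) (c := ρs * ε) (by positivity) hτα
    (fun k => by have := ha_nonneg _ (hd_mem k); positivity)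
    (fun k => by have := hδ (k + 1) k.succ_pos; positivity)
    (fun k => by
      have hs := hscheme (k + 1) k.succ_pos
      have hdk := hd (k + 1) k.succ_pos
      have hv := hddot_mem (k + 1)
      have ha := hpolar (d k) (hd_mem k) _ (Wh.smul_mem τ hv)
      have hu := sq_mul_norm_one_div_smul_sq hτ.ne' (u (k + 1) - u k)
      have hw := sq_mul_norm_one_div_smul_sq hτ.ne' (ddot (k + 1) - ddot k)
      simp only [Nat.add_sub_cancel] at hs hdk ⊢
      rw [hquad _ hv, ← hdk] at ha
      rw [sub_eq_of_eq_add' hdk, ha, real_inner_sub_self_left_eq,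
        real_inner_sub_self_left_eq] at hs
      have hcfl := mul_le_mul_of_nonneg_left (hCFL _ hv) hτ.le
      have hle : τ ^ 2 * a (ddot (k + 1)) (ddot (k + 1)) / 2
          ≤ τ * α * ‖ddot (k + 1)‖ ^ 2 / 2 := by linarith
      have hrest : 0 ≤ τ * α * (ρf / 2 * ‖u (k + 1)‖ ^ 2
          + 1 / 2 * a (d (k + 1)) (d (k + 1))) := by
        have := ha_nonneg _ (hd_mem (k + 1))
        positivity
      have hbal := mul_le_mul_of_nonneg_left hle hρ.le
      linear_combination hbal + hrest + ρs * ε * hs + ρs * ε * ρf / 2 * hu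
        + (ρs * ε) ^ 2 / 2 * hw) n
  rw [Finset.sum_add_distrib, ← Finset.mul_sum, ← add_assoc] at key
  rwa [mul_assoc (n : ℝ), mul_div_assoc (n : ℝ)]
end

section
/- Unconditional stability of the semi-implicit scheme with solid correction (Algorithm 3) with extrapolation of order r = 1: Suppose (uᵐ)_{m≥0} ⊆ F, (dᵐ)_{m≥0} ⊆ W_h and ḋ⁰ ∈ W_h are given, set ḋᵐ = ∂_τ dᵐ for m ≥ 1, and suppose the nonnegative reals (δ_m)_{m≥1} are such that for every m ≥ 1 the tested scheme equation ρ_f⟨uᵐ − uᵐ⁻¹, uᵐ⟩_F + δ_m + ρ_s ε⟨ḋᵐ − ḋᵐ⁻¹, ḋ^{m−1/2}⟩_S + τ a(dᵐ, ḋ^{m−1/2}) = 0 holds, where ḋ^{m−1/2} = ḋᵐ + (τ/(ρ_s ε)) L_h(dᵐ − dᵐ⁻¹) is the fractional-step solid velocity (extrapolation d^{m⋆} = dᵐ⁻¹). Then for every n ≥ 1 the following exact balance holds: Eⁿ + (τ²/2)‖ḋⁿ‖_s² + (τ²/(2ρ_s ε))‖L_h dⁿ‖_S² + Σ_{m=1}^{n}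 δ_m + τ² Σ_{m=1}^{n} [(ρ_f/2)‖∂_τ uᵐ‖_F² + (ρ_s ε/2)‖∂_τ ḋᵐ‖_S² + (1/2)‖∂_τ dᵐ‖_s²] + (τ²/2) Σ_{m=1}^{n} ‖ḋᵐ − ḋᵐ⁻¹‖_s² + (τ²/(2ρ_s ε)) Σ_{m=1}^{n} ‖L_h(dᵐ − dᵐ⁻¹)‖_S² = E⁰ + (τ²/2)‖ḋ⁰‖_s² + (τ²/(2ρ_s ε))‖L_h d⁰‖_S², where Eᵐ = (ρ_f/2)‖uᵐ‖_F² + (ρ_s ε/2)‖ḋᵐ‖_S² + (1/2)‖dᵐ‖_s². In particular the scheme is unconditionally stable. -/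
open RealInnerProductSpace

theorem norm_one_div_smul_sq {E : Type*} [SeminormedAddCommGroup E] [NormedSpace ℝ E]
    (t : ℝ) (x : E) : ‖(1 / t) • x‖ ^ 2 = ‖x‖ ^ 2 / t ^ 2 := by
  rw [norm_smul, mul_pow, Real.norm_eq_abs, sq_abs]
  ring

theorem two_mul_real_inner_sub_self {E : Type*} [NormedAddCommGroup E] [InnerProductSpace ℝ E]
    (x y : E) : 2 * ⟪x - y, x⟫ = ‖x‖ ^ 2 - ‖y‖ ^ 2 + ‖x - y‖ ^ 2 := by
  rw [norm_sub_sq_real, inner_sub_left, real_inner_self_eq_norm_sq, real_inner_comm x y]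
  ring

/-- The operator representing a bilinear form on a subspace is compatible with subtraction. -/
theorem map_sub_of_inner_eq_form {S : Type*} [NormedAddCommGroup S] [InnerProductSpace ℝ S]
    {W : Submodule ℝ S} {a : S → S → ℝ} {L : S → S}
    (hadd : ∀ u ∈ W, ∀ v ∈ W, ∀ w ∈ W, a (u + v) w = a u w + a v w)
    (hL_mem : ∀ w ∈ W, L w ∈ W) (hL : ∀ w ∈ W, ∀ z ∈ W, ⟪L w, z⟫ = a w z)
    {x y : S} (hx : x ∈ W) (hy : y ∈ W) : L (x - y) = L x - L y := by
  have hxy := W.sub_mem hx hy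
  have hmem : L (x - y) - (L x - L y) ∈ W :=
    W.sub_mem (hL_mem _ hxy) (W.sub_mem (hL_mem _ hx) (hL_mem _ hy))
  have hform := hadd _ hxy _ hy _ hmem
  rw [sub_add_cancel, ← hL _ hx _ hmem, ← hL _ hxy _ hmem, ← hL _ hy _ hmem] at hform
  rw [← sub_eq_zero, ← inner_self_eq_zero (𝕜 := ℝ)]
  conv_lhs => rw [inner_sub_left, inner_sub_left]
  linarith

/-- Polarization for a symmetric form that is additive in its first argument. -/
theorem two_mul_form_sub_self {S : Type*} [AddCommGroup S] [Module ℝ S]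
    {W : Submodule ℝ S} {a : S → S → ℝ}
    (hsymm : ∀ u ∈ W, ∀ v ∈ W, a u v = a v u)
    (hadd : ∀ u ∈ W, ∀ v ∈ W, ∀ w ∈ W, a (u + v) w = a u w + a v w)
    {x y : S} (hx : x ∈ W) (hy : y ∈ W) :
    2 * a x (x - y) = a x x - a y y + a (x - y) (x - y) := by
  have hxy := W.sub_mem hx hy
  have h₁ := hadd _ hxy _ hy _ hx
  have h₂ := hadd _ hxy _ hy _ hy
  have h₃ := hadd _ hxy _ hy _ hxy
  rw [sub_add_cancel] at h₁ h₂ h₃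
  linarith [hsymm _ hxy _ hx, hsymm _ hxy _ hy, hsymm _ hx _ hy]

/-- Unconditional stability (exact energy balance) of the semi-implicit scheme
with solid correction (Algorithm 3) with extrapolation of order `r = 1`
(`d^{m⋆} = dᵐ⁻¹`). -/
theorem algorithm3_unconditional_stability_order_one
    {F S : Type*}
    [NormedAddCommGroup F] [InnerProductSpace ℝ F] [CompleteSpace F]
    [NormedAddCommGroup S] [InnerProductSpace ℝ S] [CompleteSpace S]
    (Wh : Submodule ℝ S) [FiniteDimensional ℝ Wh]
    (a : S → S → ℝ)
    (hsymm : ∀ u ∈ Wh, ∀ v ∈ Wh, a u v = a v u)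
    (hadd : ∀ u ∈ Wh, ∀ v ∈ Wh, ∀ w ∈ Wh, a (u + v) w = a u w + a v w)
    (hsmul : ∀ (c : ℝ), ∀ u ∈ Wh, ∀ w ∈ Wh, a (c • u) w = c * a u w)
    (hpos : ∀ w ∈ Wh, w ≠ 0 → 0 < a w w)
    (Lh : S → S)
    (hLh_mem : ∀ w ∈ Wh, Lh w ∈ Wh)
    (hLh : ∀ w ∈ Wh, ∀ z ∈ Wh, ⟪Lh w, z⟫ = a w z)
    (ρf ρs ε τ : ℝ) (hρf : 0 < ρf) (hρs : 0 < ρs) (hε : 0 < ε) (hτ : 0 < τ)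
    (u : ℕ → F) (d ddot : ℕ → S) (δ : ℕ → ℝ)
    (hd_mem : ∀ m, d m ∈ Wh) (hddot_mem : ∀ m, ddot m ∈ Wh)
    (hδ : ∀ m, 1 ≤ m → 0 ≤ δ m)
    (hddot : ∀ m, 1 ≤ m → ddot m = (1 / τ) • (d m - d (m - 1)))
    (hscheme : ∀ m, 1 ≤ m →
      ρf * ⟪u m - u (m - 1), u m⟫ + δ m
        + ρs * ε * ⟪ddot m - ddot (m - 1),
            ddot m + (τ / (ρs * ε)) • Lh (d m - d (m - 1))⟫
        + τ * a (d m) (ddot m + (τ / (ρs * ε)) • Lh (d m - d (m - 1))) = 0) :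
    ∀ n, 1 ≤ n →
      (ρf / 2 * ‖u n‖ ^ 2 + ρs * ε / 2 * ‖ddot n‖ ^ 2 + 1 / 2 * a (d n) (d n))
        + τ ^ 2 / 2 * a (ddot n) (ddot n)
        + τ ^ 2 / (2 * ρs * ε) * ‖Lh (d n)‖ ^ 2
        + (∑ m ∈ Finset.Icc 1 n, δ m)
        + τ ^ 2 * ∑ m ∈ Finset.Icc 1 n,
            (ρf / 2 * ‖(1 / τ) • (u m - u (m - 1))‖ ^ 2
              + ρs * ε / 2 * ‖(1 / τ) • (ddot m - ddot (m - 1))‖ ^ 2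
              + 1 / 2 * a ((1 / τ) • (d m - d (m - 1))) ((1 / τ) • (d m - d (m - 1))))
        + τ ^ 2 / 2 * ∑ m ∈ Finset.Icc 1 n,
            a (ddot m - ddot (m - 1)) (ddot m - ddot (m - 1))
        + τ ^ 2 / (2 * ρs * ε) * ∑ m ∈ Finset.Icc 1 n, ‖Lh (d m - d (m - 1))‖ ^ 2
      = (ρf / 2 * ‖u 0‖ ^ 2 + ρs * ε / 2 * ‖ddot 0‖ ^ 2 + 1 / 2 * a (d 0) (d 0))
        + τ ^ 2 / 2 * a (ddot 0) (ddot 0)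
        + τ ^ 2 / (2 * ρs * ε) * ‖Lh (d 0)‖ ^ 2 := by
  have hτ0 := hτ.ne'
  have hc : ρs * ε ≠ 0 := (mul_pos hρs hε).ne'
  have hLsub {x y : S} (hx : x ∈ Wh) (hy : y ∈ Wh) : Lh (x - y) = Lh x - Lh y :=
    map_sub_of_inner_eq_form hadd hLh_mem hLh hx hy
  have hincr (m : ℕ) : d (m + 1) - d m ∈ Wh := Wh.sub_mem (hd_mem _) (hd_mem _)
  have hvincr (m : ℕ) : ddot (m + 1) - ddot m ∈ Wh := Wh.sub_mem (hddot_mem _) (hddot_mem _)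
  have hincr_eq (m : ℕ) : d (m + 1) - d m = τ • ddot (m + 1) := by
    rw [hddot _ (Nat.le_add_left 1 m), Nat.add_sub_cancel, smul_smul, mul_one_div_cancel hτ0,
      one_smul]
  have hkin (m : ℕ) : ⟪ddot (m + 1) - ddot m, Lh (d (m + 1) - d m)⟫
      = τ * a (ddot (m + 1)) (ddot (m + 1) - ddot m) := by
    rw [real_inner_comm, hLh _ (hincr m) _ (hvincr m), hincr_eq,
      hsmul _ _ (hddot_mem _) _ (hvincr m)]
  have hel (m : ℕ) : τ * a (d (m + 1)) (ddot (m + 1)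
        + (τ / (ρs * ε)) • Lh (d (m + 1) - d m))
      = a (d (m + 1)) (d (m + 1) - d m)
        + τ ^ 2 / (ρs * ε) * ⟪Lh (d (m + 1)) - Lh (d m), Lh (d (m + 1))⟫ := by
    have hLmem := hLh_mem _ (hincr m)
    rw [← hLh _ (hd_mem _) _ (Wh.add_mem (hddot_mem _) (Wh.smul_mem _ hLmem)),
      ← hLh _ (hd_mem _) _ (hincr m), inner_add_right, inner_smul_right,
      hLsub (hd_mem _) (hd_mem _), hincr_eq, inner_smul_right,
      real_inner_comm (Lh (d (m + 1)))]
    ring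
  have hform_scale (m : ℕ) : a ((1 / τ) • (d (m + 1) - d m)) ((1 / τ) • (d (m + 1) - d m))
      = a (d (m + 1) - d m) (d (m + 1) - d m) / τ ^ 2 := by
    have hmem := Wh.smul_mem (1 / τ) (hincr m)
    rw [hsmul _ _ (hincr m) _ hmem, hsymm _ (hincr m) _ hmem, hsmul _ _ (hincr m) _ (hincr m)]
    ring
  intro n hn
  clear hn
  induction n with
  | zero => simp
  | succ m ih =>
    have hs := hscheme (m + 1) (Nat.le_add_left 1 m)
    simp only [Finset.sum_Icc_succ_top (Nat.le_add_left 1 m), Nat.add_sub_cancel,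
      norm_one_div_smul_sq, hform_scale] at ih hs ⊢
    rw [hel, inner_add_right, inner_smul_right, hkin] at hs
    have hu := two_mul_real_inner_sub_self (u (m + 1)) (u m)
    have hv := two_mul_real_inner_sub_self (ddot (m + 1)) (ddot m)
    have hl := two_mul_real_inner_sub_self (Lh (d (m + 1))) (Lh (d m))
    have had := two_mul_form_sub_self hsymm hadd (hd_mem (m + 1)) (hd_mem m)
    have hav := two_mul_form_sub_self hsymm hadd (hddot_mem (m + 1)) (hddot_mem m)
    rw [← hLsub (hd_mem _) (hd_mem _)] at hl hs
    linear_combination (norm := skip) ih + hs - ρf / 2 * hu - ρs * ε / 2 * hv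
      - τ ^ 2 / (2 * ρs * ε) * hl - 1 / 2 * had - τ ^ 2 / 2 * hav
    field_simp
    ring
end
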